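/- Let a and b be positive integers with a ∣ b, let S be a gcd-closed set of distinct positive integers satisfying condition 𝒢, and let x_l, x_m ∈ S with G_S(x_m) = {x_{m₁}, x_{m₂}, x_{m₃}} consisting of exactly three elements; set x_{m_{ij}} := gcd(x_{m_i}, x_{m_j}) for 1 ≤ i < j ≤ 3 and x_{m₄} := gcd(x_{m₁}, x_{m₂}, x_{m₃}). Then the integer x_m^a − x_{m₁}^a − x_{m₂}^a − x_{m₃}^a + x_{m_{12}}^a + x_{m_{13}}^a + x_{m_{23}}^a − x_{m₄}^a divides the integer gcd(x_l, x_m)^b − gcd(x_l, x_{m₁})^b − gcd(x_l, x_{m₂})^b − gcd(x_l, x_{m₃})^b + gcd(x_l, x_{m_{12}})^b + gcd(x_l, x_{m_{13}})^b + gcd(x_l, x_{m_{23}})^b − gcd(x_l, x_{m₄})^b. -/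

import Mathlib

open Finset

def gcdClosed (S : Finset ℕ) : Prop := ∀ x ∈ S, ∀ y ∈ S, Nat.gcd x y ∈ S

/-- The set of greatest-type divisors of `x` in `S`. -/
def GTD (S : Finset ℕ) (x : ℕ) : Finset ℕ :=
  S.filter fun d => d < x ∧ d ∣ x ∧ ∀ y ∈ S, d ∣ y → y ∣ x → y = d ∨ y = x

/-- The element `x` satisfies condition 𝒢 with respect to `S`. -/
def condGAt (S : Finset ℕ) (x : ℕ) : Prop :=
  ∀ y₁ ∈ GTD S x, ∀ y₂ ∈ GTD S x, y₁ ≠ y₂ →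
    Nat.lcm y₁ y₂ = x ∧ Nat.gcd y₁ y₂ ∈ GTD S y₁ ∧ Nat.gcd y₁ y₂ ∈ GTD S y₂

/-- The set `S` satisfies condition 𝒢. -/
def condG (S : Finset ℕ) : Prop := ∀ x ∈ S, condGAt S x

/-- `c_{ij}`: the sum of `μ(d)` over positive integers `d` with `d·x_i ∣ x_j` and
`d·x_i ∤ x_t` for every `x_t ∈ S` with `x_t < x_j`. -/
def cMat {n : ℕ} (x : Fin n → ℕ) (i j : Fin n) : ℤ :=
  ∑ d ∈ (x j).divisors.filter
      (fun d => d * x i ∣ x j ∧ ∀ t : Fin n, x t < x j → ¬ d * x i ∣ x t),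
    ArithmeticFunction.moebius d

/-- `α_{ξ_a}(x_k)`: the sum of `(ξ_a * μ)(d)` over divisors `d` of `x_k` with
`d ∤ x_t` for every `x_t ∈ S` with `x_t < x_k`. -/
def alphaXi {n : ℕ} (a : ℕ) (x : Fin n → ℕ) (k : Fin n) : ℤ :=
  ∑ d ∈ (x k).divisors.filter (fun d => ∀ t : Fin n, x t < x k → ¬ d ∣ x t),
    ∑ e ∈ d.divisors, (e : ℤ) ^ a * ArithmeticFunction.moebius (d / e)

/-- `α_{1/ξ_a}(x_k)`: the sum of `((1/ξ_a) * μ)(d)` over divisors `d` of `x_k` with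
`d ∤ x_t` for every `x_t ∈ S` with `x_t < x_k`. -/
def alphaInvXi {n : ℕ} (a : ℕ) (x : Fin n → ℕ) (k : Fin n) : ℚ :=
  ∑ d ∈ (x k).divisors.filter (fun d => ∀ t : Fin n, x t < x k → ¬ d ∣ x t),
    ∑ e ∈ d.divisors, ((e : ℚ) ^ a)⁻¹ * ((ArithmeticFunction.moebius (d / e) : ℤ) : ℚ)

/-- Every proper divisor of `x` lying in `S` divides some greatest-type divisor of `x`. -/
lemma exists_mem_GTD_of_dvd {S : Finset ℕ} {x g : ℕ} (hpos : ∀ u ∈ S, 0 < u) (hx : x ∈ S)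
    (hg : g ∈ S) (hgx : g ∣ x) (hne : g ≠ x) : ∃ d ∈ GTD S x, g ∣ d := by
  have hlt : ∀ y, y ∣ x → y ≠ x → y < x := fun y hy h =>
    lt_of_le_of_ne (Nat.le_of_dvd (hpos x hx) hy) h
  obtain ⟨d, hd, hmax⟩ := Finset.exists_max_image
    (S.filter fun d => g ∣ d ∧ d ∣ x ∧ d ≠ x) id
    ⟨g, by simp [hg, hgx, hne]⟩
  simp only [Finset.mem_filter, id] at hd hmax
  obtain ⟨hdS, hgd, hdx, hdne⟩ := hd
  refine ⟨d, ?_, hgd⟩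
  simp only [GTD, Finset.mem_filter]
  refine ⟨hdS, hlt d hdx hdne, hdx, fun y hy hdy hyx => ?_⟩
  by_cases h : y = x
  · exact Or.inr h
  · exact Or.inl (le_antisymm (hmax y ⟨hy, hgd.trans hdy, hyx, h⟩)
      (Nat.le_of_dvd (hpos y hy) hdy))

lemma coprime_of_lcm_eq {x y z p q : ℕ} (hx : 0 < x) (hp : x = y * p) (hq : x = z * q)
    (h : Nat.lcm y z = x) : Nat.Coprime p q := by
  have hdiv : x * Nat.gcd p q ∣ x := by
    obtain ⟨p', hp'⟩ := Nat.gcd_dvd_left p q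
    obtain ⟨q', hq'⟩ := Nat.gcd_dvd_right p q
    have hg : 0 < p.gcd q := by
      rcases Nat.eq_zero_or_pos (p.gcd q) with h0 | h0
      · rw [h0, zero_mul] at hp'
        subst hp'
        omega
      · exact h0
    have e : y * p' = z * q' := by
      apply Nat.eq_of_mul_eq_mul_left hg
      calc p.gcd q * (y * p') = y * (p.gcd q * p') := by ring
        _ = z * (p.gcd q * q') := by rw [← hp', ← hq', ← hp, ← hq]
        _ = p.gcd q * (z * q') := by ring
    have hl : Nat.lcm y z ∣ y * p' := Nat.lcm_dvd (dvd_mul_right _ _) (e ▸ dvd_mul_right _ _)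
    rw [h] at hl
    calc x * p.gcd q ∣ y * p' * p.gcd q := mul_dvd_mul_right hl _
      _ = y * (p.gcd q * p') := by ring
      _ = x := by rw [← hp', ← hp]
  exact Nat.dvd_one.mp (Nat.dvd_of_mul_dvd_mul_left hx (by simpa using hdiv))

lemma exists_coprime_factorization_of_lcm_eq {x y₁ y₂ y₃ : ℕ} (hx : 0 < x)
    (h₁₂ : Nat.lcm y₁ y₂ = x) (h₁₃ : Nat.lcm y₁ y₃ = x) (h₂₃ : Nat.lcm y₂ y₃ = x) :
    ∃ p q r w, Nat.Coprime p q ∧ Nat.Coprime p r ∧ Nat.Coprime q r ∧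
      x = p * q * r * w ∧ y₁ = q * r * w ∧ y₂ = p * r * w ∧ y₃ = p * q * w := by
  obtain ⟨p, hp⟩ : y₁ ∣ x := h₁₂ ▸ Nat.dvd_lcm_left _ _
  obtain ⟨q, hq⟩ : y₂ ∣ x := h₁₂ ▸ Nat.dvd_lcm_right _ _
  obtain ⟨r, hr⟩ : y₃ ∣ x := h₁₃ ▸ Nat.dvd_lcm_right _ _
  have cpq := coprime_of_lcm_eq hx hp hq h₁₂
  have cpr := coprime_of_lcm_eq hx hp hr h₁₃
  have cqr := coprime_of_lcm_eq hx hq hr h₂₃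
  obtain ⟨w, hw⟩ : p * q * r ∣ x :=
    (cpr.mul_left cqr).mul_dvd_of_dvd_of_dvd
      (cpq.mul_dvd_of_dvd_of_dvd ⟨y₁, by rw [hp, mul_comm]⟩ ⟨y₂, by rw [hq, mul_comm]⟩)
      ⟨y₃, by rw [hr, mul_comm]⟩
  have hp0 : 0 < p := Nat.pos_of_ne_zero fun h => by simp [h] at hp; omega
  have hq0 : 0 < q := Nat.pos_of_ne_zero fun h => by simp [h] at hq; omega
  have hr0 : 0 < r := Nat.pos_of_ne_zero fun h => by simp [h] at hr; omega
  refine ⟨p, q, r, w, cpq, cpr, cqr, hw, ?_, ?_, ?_⟩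
  · apply Nat.eq_of_mul_eq_mul_right hp0
    rw [← hp, hw]; ring
  · apply Nat.eq_of_mul_eq_mul_right hq0
    rw [← hq, hw]; ring
  · apply Nat.eq_of_mul_eq_mul_right hr0
    rw [← hr, hw]; ring

/-- The alternating sum of the values of a power over the meet-lattice generated by three
pairwise co-maximal divisors factors as a product. -/
lemma alternating_sum_pow_eq_mul (p q r w : ℤ) (n : ℕ) :
    (p * q * r * w) ^ n - (q * r * w) ^ n - (p * r * w) ^ n - (p * q * w) ^ n
      + (r * w) ^ n + (q * w) ^ n + (p * w) ^ n - w ^ n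
      = (p ^ n - 1) * (q ^ n - 1) * (r ^ n - 1) * w ^ n := by
  simp only [mul_pow]
  ring

lemma Nat.gcd_eq_gcd_gcd_of_gcd_dvd {l x y z : ℕ} (h : Nat.gcd l x ∣ y) (hz : z ∣ x) :
    Nat.gcd l z = Nat.gcd l (Nat.gcd y z) :=
  Nat.dvd_antisymm
    (Nat.dvd_gcd (Nat.gcd_dvd_left _ _)
      (Nat.dvd_gcd ((Nat.gcd_dvd_gcd_of_dvd_right l hz).trans h) (Nat.gcd_dvd_right _ _)))
    (Nat.gcd_dvd_gcd_of_dvd_right l (Nat.gcd_dvd_right _ _))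

theorem alpha_dvd_gcd_alternating_sum
    (a b : ℕ) (ha : 0 < a) (hb : 0 < b) (hab : a ∣ b)
    (S : Finset ℕ) (hpos : ∀ u ∈ S, 0 < u) (hgcd : gcdClosed S) (hG : condG S)
    (xl xm y₁ y₂ y₃ : ℕ) (hl : xl ∈ S) (hm : xm ∈ S)
    (hGTD : GTD S xm = {y₁, y₂, y₃}) (hcard : ({y₁, y₂, y₃} : Finset ℕ).card = 3) :
    ((xm : ℤ) ^ a - (y₁ : ℤ) ^ a - (y₂ : ℤ) ^ a - (y₃ : ℤ) ^ a
      + (Nat.gcd y₁ y₂ : ℤ) ^ a + (Nat.gcd y₁ y₃ : ℤ) ^ a + (Nat.gcd y₂ y₃ : ℤ) ^ a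
      - (Nat.gcd (Nat.gcd y₁ y₂) y₃ : ℤ) ^ a) ∣
    ((Nat.gcd xl xm : ℤ) ^ b - (Nat.gcd xl y₁ : ℤ) ^ b - (Nat.gcd xl y₂ : ℤ) ^ b
      - (Nat.gcd xl y₃ : ℤ) ^ b + (Nat.gcd xl (Nat.gcd y₁ y₂) : ℤ) ^ b
      + (Nat.gcd xl (Nat.gcd y₁ y₃) : ℤ) ^ b + (Nat.gcd xl (Nat.gcd y₂ y₃) : ℤ) ^ b
      - (Nat.gcd xl (Nat.gcd (Nat.gcd y₁ y₂) y₃) : ℤ) ^ b) := by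
  have hx := hpos xm hm
  obtain ⟨hne₁₂, hne₁₃, hne₂₃⟩ : y₁ ≠ y₂ ∧ y₁ ≠ y₃ ∧ y₂ ≠ y₃ := by
    refine ⟨?_, ?_, ?_⟩ <;> rintro rfl <;> simp at hcard <;>
      exact (Nat.lt_succ_of_le Finset.card_le_two).ne hcard
  have m₁ : y₁ ∈ GTD S xm := by simp [hGTD]
  have m₂ : y₂ ∈ GTD S xm := by simp [hGTD]
  have m₃ : y₃ ∈ GTD S xm := by simp [hGTD]
  obtain ⟨p, q, r, w, cpq, cpr, cqr, rfl, rfl, rfl, rfl⟩ :=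
    exists_coprime_factorization_of_lcm_eq hx (hG xm hm _ m₁ _ m₂ hne₁₂).1
      (hG xm hm _ m₁ _ m₃ hne₁₃).1 (hG xm hm _ m₂ _ m₃ hne₂₃).1
  have g₁₂ : Nat.gcd (q * r * w) (p * r * w) = r * w := by
    rw [mul_assoc, mul_assoc, Nat.gcd_mul_right, cpq.symm.gcd_eq_one, one_mul]
  have g₁₃ : Nat.gcd (q * r * w) (p * q * w) = q * w := by
    rw [mul_comm q r, mul_assoc, mul_assoc, Nat.gcd_mul_right, cpr.symm.gcd_eq_one, one_mul]
  have g₂₃ : Nat.gcd (p * r * w) (p * q * w) = p * w := by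
    rw [mul_comm p r, mul_comm p q, mul_assoc, mul_assoc, Nat.gcd_mul_right,
      cqr.symm.gcd_eq_one, one_mul]
  have g₁₂₃ : Nat.gcd (r * w) (p * q * w) = w := by
    rw [Nat.gcd_mul_right, (cpr.mul_left cqr).symm.gcd_eq_one, one_mul]
  rw [g₁₂, g₁₃, g₂₃, g₁₂₃]
  by_cases hdvd : p * q * r * w ∣ xl
  · have key : ∀ z, z ∣ p * q * r * w → Nat.gcd xl z = z := fun z hz =>
      Nat.gcd_eq_right (hz.trans hdvd)
    rw [key _ dvd_rfl, key _ ⟨p, by ring⟩, key _ ⟨q, by ring⟩, key _ ⟨r, by ring⟩,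
      key _ ⟨p * q, by ring⟩, key _ ⟨p * r, by ring⟩, key _ ⟨q * r, by ring⟩,
      key _ ⟨p * q * r, by ring⟩]
    push_cast
    rw [alternating_sum_pow_eq_mul, alternating_sum_pow_eq_mul]
    have hpow : ∀ z : ℤ, z ^ a - 1 ∣ z ^ b - 1 := fun z => by
      obtain ⟨c, rfl⟩ := hab
      simpa [pow_mul] using sub_dvd_pow_sub_pow (z ^ a) 1 c
    exact mul_dvd_mul (mul_dvd_mul (mul_dvd_mul (hpow _) (hpow _)) (hpow _))
      (pow_dvd_pow _ (Nat.le_of_dvd hb hab))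
  · obtain ⟨d, hd, hgd⟩ := exists_mem_GTD_of_dvd hpos hm (hgcd xl hl _ hm)
      (Nat.gcd_dvd_right _ _) (fun h => hdvd (h ▸ Nat.gcd_dvd_left _ _))
    have d₁ : q * r * w ∣ p * q * r * w := ⟨p, by ring⟩
    have d₂ : p * r * w ∣ p * q * r * w := ⟨q, by ring⟩
    have d₃ : p * q * w ∣ p * q * r * w := ⟨r, by ring⟩
    have d₁₂ : r * w ∣ p * q * r * w := ⟨p * q, by ring⟩
    have d₁₃ : q * w ∣ p * q * r * w := ⟨p * r, by ring⟩
    have d₂₃ : p * w ∣ p * q * r * w := ⟨q * r, by ring⟩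
    have g₁₃₂ : Nat.gcd (p * r * w) (q * w) = w := by
      rw [Nat.gcd_mul_right, (cpq.mul_left cqr.symm).gcd_eq_one, one_mul]
    have g₂₃₁ : Nat.gcd (q * r * w) (p * w) = w := by
      rw [Nat.gcd_mul_right, (cpq.symm.mul_left cpr.symm).gcd_eq_one, one_mul]
    have key := fun z => Nat.gcd_eq_gcd_gcd_of_gcd_dvd (z := z) hgd
    refine (dvd_zero _).trans (dvd_of_eq (Eq.symm ?_))
    rw [hGTD] at hd
    simp only [Finset.mem_insert, Finset.mem_singleton] at hd
    rcases hd with rfl | rfl | rfl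
    · rw [key _ dvd_rfl, key _ d₂, key _ d₃, key _ d₂₃, g₁₂, g₁₃, g₂₃₁,
        Nat.gcd_eq_left d₁]
      ring
    · rw [key _ dvd_rfl, key _ d₁, key _ d₃, key _ d₁₃, Nat.gcd_comm (p * r * w) (q * r * w),
        g₁₂, g₂₃, g₁₃₂, Nat.gcd_eq_left d₂]
      ring
    · rw [key _ dvd_rfl, key _ d₁, key _ d₂, key _ d₁₂, Nat.gcd_comm (p * q * w) (q * r * w),
        Nat.gcd_comm (p * q * w) (p * r * w), Nat.gcd_comm (p * q * w) (r * w),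
        g₁₃, g₂₃, g₁₂₃, Nat.gcd_eq_left d₃]
      ring
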